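/- Assume the standing hypotheses and let μ be a linear form on V(χ,J,d). Write P1(a,n,k,m;C) for the bound |∫_{D(a,n)} (z−a)^k (z−a)^m dμ| ≤ C q^{n(r−|k|−|m|)}. Then the following are equivalent (with possibly different constants): (a) there exists C such that P1(a,n,k,m;C) holds for all a ∈ F, all n ∈ ℤ, all 0 ≤ k ≤ d and all m ∈ ℤ≥0^J; (b) there exists C such that P1 holds (i) for all (a,n) with D(a,n) ∩ ϖO_F = ∅ and all k, m; (ii) for all a ∈ ϖO_F, all n ≥ 1 and all k, m; and (iii) for a = 0, all integers n ≤ 0, and those k, m with r − (|k|+|m|) > 0. -/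

import Mathlib

/- Preamble: formalization of the basic objects from "Fonctions de classe C^r sur O_F"
   (C^r functions on O_F, locally analytic functions, locally J-analytic characters,
   the spaces V(χ,J,d), B(χ,J,d), the lattice Λ, etc.).

   Conventions:
   * F, E are nonarchimedean complete normed fields (abstracting finite extensions of ℚ_p);
   * O_F is encoded by the predicate ‖·‖ ≤ 1, and functions on O_F are encoded as
     functions on F whose defining conditions only quantify over the unit ball;
   * `q` is the residue cardinality, `ϖ` a uniformizer with ‖ϖ‖ = q⁻¹,
     and D(a,n) = {z : ‖z - a‖ ≤ q^(-n)};
   * S is the (finite) set of embeddings F → E, `emb σ` the corresponding ring maps;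
   * multi-indices are functions `i : S → ℕ`; a pair (k over S∖J, m over J) is encoded
     as the single multi-index agreeing with k off J and with m on J. -/

open scoped Classical Topology
open Filter

noncomputable section

namespace Paper

variable {F E : Type*} [NormedField F] [NormedField E]
variable {S : Type*} [Fintype S]

/-- total degree |i| of a multi-index -/
def mSum (i : S → ℕ) : ℕ := ∑ σ, i σ

/-- i! -/
def mFact (i : S → ℕ) : ℕ := ∏ σ, (i σ).factorial

/-- z^i = ∏_σ σ(z)^(i_σ) -/
def mPow (emb : S → (F →+* E)) (z : F) (i : S → ℕ) : E := ∏ σ, (emb σ z) ^ (i σ)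

/-- the (finite) set of multi-indices of total degree ≤ N -/
def degLE (S : Type*) [Fintype S] (N : ℕ) : Finset (S → ℕ) :=
  ((Finset.univ : Finset (S → Fin (N + 1))).image (fun i σ => (i σ : ℕ))).filter
    (fun i => mSum i ≤ N)

/-- the remainder ε_{f,N}(x,y) = f(x+y) - Σ_{|i| ≤ N} D_i f(x) y^i / i! -/
def crRem (emb : S → (F →+* E)) (N : ℕ) (f : F → E) (Df : (S → ℕ) → F → E)
    (x y : F) : E :=
  f (x + y) - ∑ i ∈ degLE S N, Df i x * mPow emb y i / (mFact i : E)

/-- `f` is of class C^r on O_F with derivative data `Df`: the `Df i` (|i| ≤ ⌊r⌋) are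
bounded on O_F and C_{f,r}(h) = sup_{x ∈ O_F, y ∈ ϖ^h O_F} |ε_{f,[r]}(x,y)| q^{rh} → 0. -/
def IsCrWith (q : ℕ) (emb : S → (F →+* E)) (r : ℝ) (f : F → E)
    (Df : (S → ℕ) → F → E) : Prop :=
  (∀ i : S → ℕ, mSum i ≤ ⌊r⌋₊ → ∃ C : ℝ, ∀ x : F, ‖x‖ ≤ 1 → ‖Df i x‖ ≤ C) ∧
  ∀ ε : ℝ, 0 < ε → ∃ H : ℕ, ∀ h : ℕ, H ≤ h → ∀ x y : F, ‖x‖ ≤ 1 →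
    ‖y‖ ≤ (q : ℝ) ^ (-(h : ℤ)) →
      ‖crRem emb ⌊r⌋₊ f Df x y‖ * (q : ℝ) ^ (r * (h : ℝ)) ≤ ε

/-- `f` is of class C^r on O_F -/
def IsCr (q : ℕ) (emb : S → (F →+* E)) (r : ℝ) (f : F → E) : Prop :=
  ∃ Df, IsCrWith q emb r f Df

/-- the C^r norm computed from derivative data `Df` -/
def crNormWith (emb : S → (F →+* E)) (r : ℝ) (f : F → E)
    (Df : (S → ℕ) → F → E) : ℝ :=
  sSup ({x | ∃ i : S → ℕ, mSum i ≤ ⌊r⌋₊ ∧ ∃ z : F, ‖z‖ ≤ 1 ∧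
          x = ‖Df i z / (mFact i : E)‖} ∪
        {x | ∃ z y : F, ‖z‖ ≤ 1 ∧ ‖y‖ ≤ 1 ∧ y ≠ 0 ∧
          x = ‖crRem emb ⌊r⌋₊ f Df z y‖ / ‖y‖ ^ r})

/-- the C^r norm of `f` (the derivative data being unique, the set below is a singleton
when `f` is of class C^r). -/
def crNorm (q : ℕ) (emb : S → (F →+* E)) (r : ℝ) (f : F → E) : ℝ :=
  sSup {c | ∃ Df, IsCrWith q emb r f Df ∧ c = crNormWith emb r f Df}

/-- membership in the closed subspace C^r(O_F, J, d) of C^r(O_F, E):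
∂^{dσ+1} f / ∂z_σ^{dσ+1} = 0 for σ ∉ J. -/
def IsCrJ (q : ℕ) (emb : S → (F →+* E)) (r : ℝ) (J : Set S) (d : S → ℕ)
    (f : F → E) : Prop :=
  ∃ Df, IsCrWith q emb r f Df ∧
    ∀ σ : S, σ ∉ J → ∀ x : F, ‖x‖ ≤ 1 → Df (Pi.single σ (d σ + 1)) x = 0

/-- `c` is the family of Taylor coefficients of an expansion of `f` on D(a,h), with
exponents bounded by `d` off `J`, and coefficients with ‖c m‖ q^{-h|m|} → 0. -/
def IsExpansionAt (q : ℕ) (emb : S → (F →+* E)) (J : Set S) (d : S → ℕ) (h : ℕ)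
    (a : F) (c : (S → ℕ) → E) (f : F → E) : Prop :=
  (∀ m : S → ℕ, ¬ (∀ σ, σ ∉ J → m σ ≤ d σ) → c m = 0) ∧
  Tendsto (fun m : S → ℕ => ‖c m‖ * (q : ℝ) ^ (-(h : ℝ) * (mSum m : ℝ)))
    cofinite (nhds 0) ∧
  ∀ z : F, ‖z - a‖ ≤ (q : ℝ) ^ (-(h : ℤ)) →
    HasSum (fun m : S → ℕ => c m * mPow emb (z - a) m) (f z)

/-- membership in F_h(O_F, J, d) -/
def IsFh (q : ℕ) (emb : S → (F →+* E)) (J : Set S) (d : S → ℕ) (h : ℕ)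
    (f : F → E) : Prop :=
  ∀ a : F, ‖a‖ ≤ 1 → ∃ c : (S → ℕ) → E, IsExpansionAt q emb J d h a c f

/-- membership in F(O_F, J, d) = ∪_h F_h(O_F, J, d) -/
def IsF (q : ℕ) (emb : S → (F →+* E)) (J : Set S) (d : S → ℕ) (f : F → E) : Prop :=
  ∃ h : ℕ, IsFh q emb J d h f

/-- the norm of F_h(O_F, J, d) -/
def FhNorm (q : ℕ) (emb : S → (F →+* E)) (J : Set S) (d : S → ℕ) (h : ℕ)
    (f : F → E) : ℝ :=
  sSup {x | ∃ a : F, ‖a‖ ≤ 1 ∧ ∃ c : (S → ℕ) → E, IsExpansionAt q emb J d h a c f ∧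
        ∃ m : S → ℕ, x = ‖c m‖ * (q : ℝ) ^ (-(h : ℝ) * (mSum m : ℝ))}

/-- membership in F^N(O_F, J, d): member of F(O_F,J,d) which is a sum of members of the
spaces F(O_F, ∅, d'') over multi-indices d'' of total degree ≤ N. -/
def IsFN (q : ℕ) (emb : S → (F →+* E)) (J : Set S) (d : S → ℕ) (N : ℕ)
    (f : F → E) : Prop :=
  IsF q emb J d f ∧ ∃ g : (S → ℕ) → (F → E),
    (∀ m ∈ degLE S N, IsF q emb (∅ : Set S) m (g m)) ∧
    ∀ z : F, ‖z‖ ≤ 1 → f z = ∑ m ∈ degLE S N, g m z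

/-- |d| = Σ_{σ ∉ J} d_σ -/
def dSum (J : Set S) (d : S → ℕ) : ℕ :=
  ∑ σ ∈ Finset.univ.filter (fun σ => σ ∉ J), d σ

/-- z^d = ∏_{σ ∉ J} σ(z)^{d_σ} -/
def dPow (emb : S → (F →+* E)) (J : Set S) (d : S → ℕ) (z : F) : E :=
  ∏ σ ∈ Finset.univ.filter (fun σ => σ ∉ J), (emb σ z) ^ (d σ)

/-- z^{d-k} z^{-m} where (k, m) is encoded by the single multi-index `i`
(k = i off J, m = i on J). -/
def negPow (emb : S → (F →+* E)) (J : Set S) (d : S → ℕ) (i : S → ℕ) (z : F) : E :=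
  (∏ σ ∈ Finset.univ.filter (fun σ => σ ∉ J), (emb σ z) ^ (d σ - i σ)) /
    (∏ σ ∈ Finset.univ.filter (fun σ => σ ∈ J), (emb σ z) ^ (i σ))

/-- the function 1_{D(a,n)}(z) (z-a)^i -/
def test1 (q : ℕ) (emb : S → (F →+* E)) (a : F) (n : ℤ) (i : S → ℕ) : F → E :=
  fun z => if ‖z - a‖ ≤ (q : ℝ) ^ (-n) then mPow emb (z - a) i else 0

/-- the function χ2 χ1⁻¹ -/
def chRatio (χ1 χ2 : F →* E) (z : F) : E := χ2 z / χ1 z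

/-- the function 1_{F∖D(a,n+1)}(z) χ2χ1⁻¹(z-a) (z-a)^{d-k} (z-a)^{-m} -/
def test2 (q : ℕ) (emb : S → (F →+* E)) (J : Set S) (d : S → ℕ) (χ1 χ2 : F →* E)
    (a : F) (n : ℤ) (i : S → ℕ) : F → E :=
  fun z => if ‖z - a‖ ≤ (q : ℝ) ^ (-(n + 1)) then 0
    else chRatio χ1 χ2 (z - a) * negPow emb J d i (z - a)

/-- the ϖ-adic valuation v(a) (so that ‖a‖ = q^{-v(a)} for a ≠ 0) -/
def valF (q : ℕ) (a : F) : ℤ := ⌊-(Real.logb q ‖a‖)⌋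

/-- the function 1_{D(1/a, n - 2v(a))}(z) χ2χ1⁻¹(z) z^d (1/z - a)^k (1/z - a)^m -/
def test3 (q : ℕ) (emb : S → (F →+* E)) (J : Set S) (d : S → ℕ) (χ1 χ2 : F →* E)
    (a : F) (n : ℤ) (i : S → ℕ) : F → E :=
  fun z => if ‖z - a⁻¹‖ ≤ (q : ℝ) ^ (-(n - 2 * valF q a))
    then chRatio χ1 χ2 z * dPow emb J d z * mPow emb (z⁻¹ - a) i else 0

/-- locally J-analytic character: continuous on F^× and, on each disk D(a,l) around a
unit, given by a convergent power series in the variables (σ(z) - σ(a))_{σ ∈ J}. -/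
def IsLocJChar (q : ℕ) (emb : S → (F →+* E)) (J : Set S) (χ : F →* E) : Prop :=
  ContinuousOn (χ : F → E) {z : F | z ≠ 0} ∧
  ∃ l : ℕ, ∀ a : F, ‖a‖ = 1 → ∃ c : (S → ℕ) → E,
    (∀ m : S → ℕ, ¬ (∀ σ, σ ∉ J → m σ = 0) → c m = 0) ∧
    ∀ z : F, ‖z - a‖ ≤ (q : ℝ) ^ (-(l : ℤ)) →
      HasSum (fun m : S → ℕ => c m * mPow emb (z - a) m) (χ z)

/-- the valuation v_p on E normalized by v_p(p) = 1, given that ‖x‖ = p^{-ef·v_p(x)}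
(ef = [F:ℚ_p]). -/
def vP (p : ℕ) (ef : ℕ) (x : E) : ℝ := -(Real.logb p ‖x‖) / (ef : ℝ)

/-- the monomial character z ↦ ∏_{σ ∈ T} σ(z)^{d_σ} -/
def monChar (emb : S → (F →+* E)) (T : Set S) (d : S → ℕ) : F →* E where
  toFun z := ∏ σ ∈ Finset.univ.filter (fun σ => σ ∈ T), (emb σ z) ^ (d σ)
  map_one' := by simp
  map_mul' := by
    intro x y
    simp [map_mul, mul_pow, Finset.prod_mul_distrib]

/-- `g` is (on O_F ∖ {0}) the function z ↦ χ2χ1⁻¹(z) z^d f(1/z); i.e. `g` is an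
extension to O_F of the second-chart transform of `f`. -/
def ExtProp (emb : S → (F →+* E)) (J : Set S) (d : S → ℕ) (χ1 χ2 : F →* E)
    (f g : F → E) : Prop :=
  ∀ z : F, z ≠ 0 → ‖z‖ ≤ 1 → g z = chRatio χ1 χ2 z * dPow emb J d z * f z⁻¹

/-- membership in V(χ, J, d) (global sections of the locally analytic sheaf) -/
def MemV (q : ℕ) (emb : S → (F →+* E)) (J : Set S) (d : S → ℕ) (χ1 χ2 : F →* E)
    (f : F → E) : Prop :=
  IsF q emb J d f ∧ ∃ g : F → E, IsF q emb J d g ∧ ExtProp emb J d χ1 χ2 f g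

/-- membership in the Banach space B(χ, J, d) -/
def MemB (q : ℕ) (emb : S → (F →+* E)) (r : ℝ) (J : Set S) (d : S → ℕ)
    (χ1 χ2 : F →* E) (f : F → E) : Prop :=
  IsCrJ q emb r J d f ∧ ∃ g : F → E, IsCrJ q emb r J d g ∧ ExtProp emb J d χ1 χ2 f g

/-- the norm of B(χ, J, d): ‖f‖_B = max(‖f₁‖_{C^r}, ‖f₂‖_{C^r}) where
f₁(z) = f(ϖ z) and f₂ is the extension of z ↦ χ2χ1⁻¹(z) z^d f(1/z). -/
def BNorm (q : ℕ) (emb : S → (F →+* E)) (r : ℝ) (J : Set S) (d : S → ℕ)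
    (χ1 χ2 : F →* E) (ϖ : F) (f : F → E) : ℝ :=
  sSup {x | ∃ g : F → E, IsCrJ q emb r J d g ∧ ExtProp emb J d χ1 χ2 f g ∧
    x = max (crNorm q emb r (fun z => f (ϖ * z))) (crNorm q emb r g)}

/-- the ring of integers O_E as a subring of E -/
def unitBall (E : Type*) [NormedField E] [IsUltrametricDist E] : Subring E where
  carrier := {x : E | ‖x‖ ≤ 1}
  mul_mem' := by
    intro a b ha hb
    simp only [Set.mem_setOf_eq] at *
    calc ‖a * b‖ = ‖a‖ * ‖b‖ := norm_mul a b
    _ ≤ 1 * 1 := mul_le_mul ha hb (norm_nonneg b) zero_le_one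
    _ = 1 := one_mul 1
  one_mem' := by simp
  add_mem' := by
    intro a b ha hb
    simp only [Set.mem_setOf_eq] at *
    exact le_trans (IsUltrametricDist.norm_add_le_max a b) (max_le ha hb)
  zero_mem' := by simp
  neg_mem' := by
    intro a ha
    simpa using ha

instance (E : Type*) [NormedField E] [IsUltrametricDist E] :
    Algebra (unitBall E) E := (unitBall E).subtype.toAlgebra

/-- the action of the Borel element [[t, u], [0, v]] on functions -/
def borelAct (emb : S → (F →+* E)) (J : Set S) (d : S → ℕ) (χ1 χ2 : F →* E)
    (t u v : F) (f : F → E) : F → E :=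
  fun z => χ1 (t * v) * chRatio χ1 χ2 t * dPow emb J d t * f ((v * z - u) / t)

/-- the generator 1_{O_F}(z) z^k z^m -/
def genPoly (emb : S → (F →+* E)) (i : S → ℕ) : F → E :=
  fun z => if ‖z‖ ≤ 1 then mPow emb z i else 0

/-- the generator 1_{F∖O_F}(z) χ2χ1⁻¹(z) z^{d-k} z^{-m} -/
def genSing (emb : S → (F →+* E)) (J : Set S) (d : S → ℕ) (χ1 χ2 : F →* E)
    (i : S → ℕ) : F → E :=
  fun z => if ‖z‖ ≤ 1 then 0 else chRatio χ1 χ2 z * negPow emb J d i z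

/-- the generating set of Λ: Borel translates of the basic generators -/
def lambdaGens (emb : S → (F →+* E)) (J : Set S) (d : S → ℕ) (χ1 χ2 : F →* E) :
    Set (F → E) :=
  {h | ∃ t u v : F, ∃ i : S → ℕ, t ≠ 0 ∧ v ≠ 0 ∧ (∀ σ, σ ∉ J → i σ ≤ d σ) ∧
    (h = borelAct emb J d χ1 χ2 t u v (genPoly emb i) ∨
     h = borelAct emb J d χ1 χ2 t u v (genSing emb J d χ1 χ2 i))}

/-- the O_E[P]-lattice Λ -/
def Lambda [IsUltrametricDist E] (emb : S → (F →+* E)) (J : Set S) (d : S → ℕ)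
    (χ1 χ2 : F →* E) : Submodule ↥(unitBall E) (F → E) :=
  Submodule.span ↥(unitBall E) (lambdaGens emb J d χ1 χ2)

/-- the gauge (jauge) ‖f‖_Λ = inf{‖λ‖ : λ ∈ E^×, f ∈ λΛ} of a lattice Λ -/
def lamGauge [IsUltrametricDist E] (Λ : Submodule ↥(unitBall E) (F → E))
    (f : F → E) : ℝ :=
  sInf {c : ℝ | ∃ lam : E, lam ≠ 0 ∧ c = ‖lam‖ ∧ ∃ g, g ∈ Λ ∧ f = lam • g}

/-- the formula for the action of g = (a b; c d) ∈ GL₂(F):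
(g·f)(z) = χ1(det g) χ2χ1⁻¹(-cz+a) (-cz+a)^d f((dz-b)/(-cz+a)) -/
def actFormula (emb : S → (F →+* E)) (J : Set S) (d : S → ℕ) (χ1 χ2 : F →* E)
    (g : Matrix (Fin 2) (Fin 2) F) (f : F → E) : F → E :=
  fun z => χ1 (g 0 0 * g 1 1 - g 0 1 * g 1 0) *
    chRatio χ1 χ2 (-(g 1 0) * z + g 0 0) * dPow emb J d (-(g 1 0) * z + g 0 0) *
    f ((g 1 1 * z - g 0 1) / (-(g 1 0) * z + g 0 0))

/-- the action of g ∈ GL₂(F) on functions, extended by continuity (i.e. by taking the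
limit) at the singular point z = a/c when c ≠ 0. -/
def gAct (emb : S → (F →+* E)) (J : Set S) (d : S → ℕ) (χ1 χ2 : F →* E)
    (g : Matrix (Fin 2) (Fin 2) F) (f : F → E) : F → E :=
  fun z => if g 1 0 ≠ 0 ∧ z = g 0 0 / g 1 0 then
      limUnder (𝓝[≠] z) (actFormula emb J d χ1 χ2 g f)
    else actFormula emb J d χ1 χ2 g f z

/-- μ belongs to I(χ,J,d)^∨: both components of μ restrict to continuous linear forms
on each Banach space F_h(O_F,J,d). -/
def MemIdual (q : ℕ) (emb : S → (F →+* E)) (J : Set S) (d : S → ℕ) (χ1 χ2 : F →* E)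
    (ϖ : F) (μ : (F → E) →ₗ[E] E) : Prop :=
  ∀ h : ℕ, ∃ K : ℝ, ∀ f g : F → E,
    IsFh q emb J d h (fun z => f (ϖ * z)) → IsFh q emb J d h g →
    ExtProp emb J d χ1 χ2 f g →
    ‖μ f‖ ≤ K * max (FhNorm q emb J d h (fun z => f (ϖ * z))) (FhNorm q emb J d h g)

/-- ν is a continuous (= bounded) linear form on the Banach space B(χ,J,d) -/
def BBounded (q : ℕ) (emb : S → (F →+* E)) (r : ℝ) (J : Set S) (d : S → ℕ)
    (χ1 χ2 : F →* E) (ϖ : F) (ν : (F → E) →ₗ[E] E) : Prop :=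
  ∃ K : ℝ, ∀ f : F → E, MemB q emb r J d χ1 χ2 f →
    ‖ν f‖ ≤ K * BNorm q emb r J d χ1 χ2 ϖ f

/-- the function z ↦ z^k z^m (a generator of L(χ,J,d)) -/
def lFun1 (emb : S → (F →+* E)) (i : S → ℕ) : F → E := fun z => mPow emb z i

/-- the function z ↦ χ2χ1⁻¹(z-a) (z-a)^{d-k} (z-a)^{-m} (value 0 at z = a),
a generator of L(χ,J,d) -/
def lFun2 (emb : S → (F →+* E)) (J : Set S) (d : S → ℕ) (χ1 χ2 : F →* E)
    (a : F) (i : S → ℕ) : F → E :=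
  fun z => if z = a then 0 else chRatio χ1 χ2 (z - a) * negPow emb J d i (z - a)

/-- the generating set of L(χ,J,d) -/
def lGens (emb : S → (F →+* E)) (J : Set S) (d : S → ℕ) (χ1 χ2 : F →* E)
    (r : ℝ) : Set (F → E) :=
  {h | ∃ i : S → ℕ, (∀ σ, σ ∉ J → i σ ≤ d σ) ∧ (mSum i : ℝ) < r ∧
    (h = lFun1 emb i ∨ ∃ a : F, h = lFun2 emb J d χ1 χ2 a i)}

/-- the distance in B(χ,J,d) from f to the subspace L(χ,J,d), i.e. the quotient
seminorm of B(χ,J,d)/L(χ,J,d) evaluated at the image of f. -/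
def distL (q : ℕ) (emb : S → (F →+* E)) (r : ℝ) (J : Set S) (d : S → ℕ)
    (χ1 χ2 : F →* E) (ϖ : F) (f : F → E) : ℝ :=
  sInf {x | ∃ l ∈ Submodule.span E (lGens emb J d χ1 χ2 r),
    x = BNorm q emb r J d χ1 χ2 ϖ (f - l)}

/-- the GL₂(F)-stable lattice generated by Λ under the group action -/
def LambdaG [IsUltrametricDist E] (emb : S → (F →+* E)) (J : Set S) (d : S → ℕ)
    (χ1 χ2 : F →* E) : Submodule ↥(unitBall E) (F → E) :=
  Submodule.span ↥(unitBall E)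
    {h | ∃ g : Matrix (Fin 2) (Fin 2) F, g 0 0 * g 1 1 - g 0 1 * g 1 0 ≠ 0 ∧
      ∃ x, x ∈ Lambda emb J d χ1 χ2 ∧ h = gAct emb J d χ1 χ2 g x}

/-- C^{r,id} remainder for h : O_F → F -/
def crRemId (N : ℕ) (h : F → F) (Dh : ℕ → F → F) (x y : F) : F :=
  h (x + y) - ∑ i ∈ Finset.range (N + 1), Dh i x * y ^ i / (Nat.factorial i : F)

/-- h : O_F → F is of class C^{r,id} -/
def IsCrId (q : ℕ) (r : ℝ) (h : F → F) : Prop :=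
  ∃ Dh : ℕ → F → F,
    (∀ i : ℕ, i ≤ ⌊r⌋₊ → ∃ C : ℝ, ∀ x : F, ‖x‖ ≤ 1 → ‖Dh i x‖ ≤ C) ∧
    ∀ ε : ℝ, 0 < ε → ∃ K : ℕ, ∀ k : ℕ, K ≤ k → ∀ x y : F, ‖x‖ ≤ 1 →
      ‖y‖ ≤ (q : ℝ) ^ (-(k : ℤ)) → ‖crRemId ⌊r⌋₊ h Dh x y‖ * (q : ℝ) ^ (r * (k : ℝ)) ≤ ε

/-- the set of values defining the dual norm ‖μ‖_{r,d} -/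
def dualSet (q : ℕ) (emb : S → (F →+* E)) (r : ℝ) (J : Set S) (d : S → ℕ)
    (μ : (F → E) →ₗ[E] E) : Set ℝ :=
  {x | ∃ (a : F) (n : ℕ) (i : S → ℕ), ‖a‖ ≤ 1 ∧ (∀ σ, σ ∉ J → i σ ≤ d σ) ∧
    x = ‖μ (test1 q emb a (n : ℤ) i)‖ * (q : ℝ) ^ (-(n : ℝ) * (r - (mSum i : ℝ)))}

/-- the dual norm ‖μ‖_{r,d} -/
def dualNorm (q : ℕ) (emb : S → (F →+* E)) (r : ℝ) (J : Set S) (d : S → ℕ)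
    (μ : (F → E) →ₗ[E] E) : ℝ :=
  sSup (dualSet q emb r J d μ)

/-- the operator norm of μ on C^r(O_F, J, d) -/
def opNorm (q : ℕ) (emb : S → (F →+* E)) (r : ℝ) (J : Set S) (d : S → ℕ)
    (μ : (F → E) →ₗ[E] E) : ℝ :=
  sSup {x | ∃ f : F → E, IsCrJ q emb r J d f ∧ crNorm q emb r f ≠ 0 ∧
    x = ‖μ f‖ / crNorm q emb r f}


/-- Multi-index binomial expansion of `(x + y)^i`. -/
lemma mPow_add (emb : S → (F →+* E)) (x y : F) (i : S → ℕ) :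
    mPow emb (x + y) i = ∑ j ∈ Fintype.piFinset (fun σ => Finset.range (i σ + 1)),
      ((∏ σ, ((i σ).choose (j σ) : ℕ) : ℕ) : E) * mPow emb y (fun σ => i σ - j σ) *
        mPow emb x j := by
  simp only [mPow, map_add, add_pow]
  rw [Finset.prod_univ_sum]
  refine Finset.sum_congr rfl fun j _ => ?_
  push_cast
  rw [← Finset.prod_mul_distrib, ← Finset.prod_mul_distrib]
  refine Finset.prod_congr rfl fun σ _ => ?_
  ring

lemma norm_mPow {emb : S → (F →+* E)} (hemb : ∀ (σ : S) (z : F), ‖emb σ z‖ = ‖z‖)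
    (z : F) (i : S → ℕ) : ‖mPow emb z i‖ = ‖z‖ ^ mSum i := by
  simp [mPow, mSum, norm_prod, hemb, Finset.prod_pow_eq_pow_sum]

/-- The function `1_{D(a,n)}(z) (z-b)^i`, whose monomial is centred at a point `b` which may
differ from the centre of the disk. -/
def diskMono (q : ℕ) (emb : S → (F →+* E)) (a b : F) (n : ℤ) (i : S → ℕ) : F → E :=
  fun z => if ‖z - a‖ ≤ (q : ℝ) ^ (-n) then mPow emb (z - b) i else 0

lemma diskMono_eq_sum (q : ℕ) (emb : S → (F →+* E)) (a b : F) (n : ℤ) (i : S → ℕ) :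
    diskMono q emb a b n i = ∑ j ∈ Fintype.piFinset (fun σ => Finset.range (i σ + 1)),
      (((∏ σ, ((i σ).choose (j σ) : ℕ) : ℕ) : E) * mPow emb (a - b) (fun σ => i σ - j σ)) •
        test1 q emb a n j := by
  funext z
  simp only [diskMono, test1, Finset.sum_apply, Pi.smul_apply, smul_eq_mul]
  split_ifs
  · rw [← mPow_add, sub_add_sub_cancel]
  · simp

/-- Recentring estimate: if `‖a - b‖ ≤ q^{-l}`, bounds for the monomials centred at `a` on
`D(a,n)` give a bound for the monomial centred at `b` on the same disk. -/
lemma norm_diskMono_le [IsUltrametricDist E] {q : ℕ} (hq : 0 < q) {emb : S → (F →+* E)}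
    (hemb : ∀ (σ : S) (z : F), ‖emb σ z‖ = ‖z‖) (μ : (F → E) →ₗ[E] E)
    {a b : F} {n l : ℤ} {i : S → ℕ} {s M : ℝ} (hM : 0 ≤ M)
    (hab : ‖a - b‖ ≤ (q : ℝ) ^ (-l))
    (h : ∀ j : S → ℕ, (∀ σ, j σ ≤ i σ) →
      ‖μ (test1 q emb a n j)‖ ≤ M * (q : ℝ) ^ ((l : ℝ) * (s - (mSum j : ℝ)))) :
    ‖μ (diskMono q emb a b n i)‖ ≤ M * (q : ℝ) ^ ((l : ℝ) * (s - (mSum i : ℝ))) := by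
  have hq' : (0 : ℝ) < q := by exact_mod_cast hq
  rw [diskMono_eq_sum, map_sum]
  refine IsUltrametricDist.norm_sum_le_of_forall_le_of_nonneg (by positivity) fun j hj => ?_
  have hji : ∀ σ, j σ ≤ i σ := fun σ => by
    have := Fintype.mem_piFinset.1 hj σ
    simpa [Nat.lt_succ_iff] using this
  have hsum : mSum (fun σ => i σ - j σ) + mSum j = mSum i := by
    simp only [mSum, ← Finset.sum_add_distrib]
    exact Finset.sum_congr rfl fun σ _ => Nat.sub_add_cancel (hji σ)
  have hpow : ‖a - b‖ ^ mSum (fun σ => i σ - j σ) ≤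
      (q : ℝ) ^ (-(l : ℝ) * (mSum (fun σ => i σ - j σ) : ℝ)) := by
    calc ‖a - b‖ ^ mSum (fun σ => i σ - j σ)
        ≤ ((q : ℝ) ^ (-l)) ^ mSum (fun σ => i σ - j σ) := by gcongr
      _ = _ := by rw [Real.rpow_mul_natCast hq'.le, ← Real.rpow_intCast]; push_cast; rfl
  rw [map_smul, smul_eq_mul, norm_mul, norm_mul, norm_mPow hemb]
  calc _ ≤ 1 * (q : ℝ) ^ (-(l : ℝ) * (mSum (fun σ => i σ - j σ) : ℝ)) *
        (M * (q : ℝ) ^ ((l : ℝ) * (s - (mSum j : ℝ)))) := by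
        gcongr
        · exact IsUltrametricDist.norm_natCast_le_one E _
        · exact h j hji
    _ = M * ((q : ℝ) ^ (-(l : ℝ) * (mSum (fun σ => i σ - j σ) : ℝ)) *
        (q : ℝ) ^ ((l : ℝ) * (s - (mSum j : ℝ)))) := by ring
    _ = _ := by
        rw [← Real.rpow_add hq', ← hsum]
        push_cast
        ring_nf

/-- The disk of a monomial may be recentred at any of its points. -/
lemma diskMono_congr_center [IsUltrametricDist F] (q : ℕ) (emb : S → (F →+* E))
    {a a' : F} (b : F) {n : ℤ} (i : S → ℕ) (h : ‖a - a'‖ ≤ (q : ℝ) ^ (-n)) :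
    diskMono q emb a b n i = diskMono q emb a' b n i := by
  funext z
  have key : ‖z - a‖ ≤ (q : ℝ) ^ (-n) ↔ ‖z - a'‖ ≤ (q : ℝ) ^ (-n) := by
    constructor <;> intro hz
    · rw [← sub_add_sub_cancel z a a']
      exact (IsUltrametricDist.norm_add_le_max _ _).trans (max_le hz h)
    · rw [← sub_add_sub_cancel z a' a]
      exact (IsUltrametricDist.norm_add_le_max _ _).trans (max_le hz (norm_sub_rev a a' ▸ h))
  simp only [diskMono, key]

/-- Splitting of a disk of level `n` into disks of level `n + 1`. -/
lemma test1_eq_sum_diskMono [IsUltrametricDist F] {q : ℕ} (hq : 1 ≤ q)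
    (emb : S → (F →+* E)) (a : F) (n : ℤ) (i : S → ℕ) (R : Finset F)
    (hR : ∀ x ∈ R, ‖x - a‖ ≤ (q : ℝ) ^ (-n))
    (hR' : ∀ z : F, ‖z - a‖ ≤ (q : ℝ) ^ (-n) →
      ∃! x, x ∈ R ∧ ‖z - x‖ ≤ (q : ℝ) ^ (-(n + 1))) :
    test1 q emb a n i = ∑ x ∈ R, diskMono q emb x a (n + 1) i := by
  have hle : (q : ℝ) ^ (-(n + 1)) ≤ (q : ℝ) ^ (-n) :=
    zpow_le_zpow_right₀ (by exact_mod_cast hq) (by omega)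
  funext z
  simp only [test1, diskMono, Finset.sum_apply]
  split_ifs with hz
  · obtain ⟨x, ⟨hxR, hzx⟩, huniq⟩ := hR' z hz
    rw [Finset.sum_eq_single_of_mem x hxR, if_pos hzx]
    intro y hy hyx
    exact if_neg fun hzy => hyx (huniq y ⟨hy, hzy⟩)
  · refine (Finset.sum_eq_zero fun x hx => if_neg fun hzx => hz ?_).symm
    rw [← sub_add_sub_cancel z x a]
    exact (IsUltrametricDist.norm_add_le_max _ _).trans (max_le (hzx.trans hle) (hR x hx))

/-- Lemme "condisupp1": under the standing hypotheses, for a linear form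
μ on V(χ,J,d), the family of bounds P1(a,n,k,m) on |∫_{D(a,n)}(z-a)^k(z-a)^m dμ| holds
for all a ∈ F, n ∈ ℤ, 0 ≤ k ≤ d, m ∈ ℤ≥0^J (for some constant) iff it holds (for some
constant) (i) on disks disjoint from ϖO_F, (ii) for a ∈ ϖO_F and n ≥ 1, and (iii) for
a = 0, n ≤ 0 and those (k,m) with r - (|k|+|m|) > 0. -/
theorem statement12
    {p q e f0 : ℕ} (hp : 1 < p) (hf0 : 0 < f0) (he : 0 < e) (hq : q = p ^ f0)
    {F E : Type*} [NormedField F] [NormedField E]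
    [IsUltrametricDist F] [IsUltrametricDist E]
    [CompleteSpace F] [CompleteSpace E]
    (ϖ : F) (hϖ : ‖ϖ‖ = (q : ℝ)⁻¹)
    (hval : ∀ x : F, x ≠ 0 → ∃ n : ℤ, ‖x‖ = (q : ℝ) ^ n)
    (hres : ∀ (a : F) (n : ℤ), ∃ R : Finset F, R.card = q ∧
      (∀ x ∈ R, ‖x - a‖ ≤ (q : ℝ) ^ (-n)) ∧
      ∀ z : F, ‖z - a‖ ≤ (q : ℝ) ^ (-n) → ∃! x, x ∈ R ∧ ‖z - x‖ ≤ (q : ℝ) ^ (-(n + 1)))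
    (hpF : ‖(p : F)‖ = (q : ℝ) ^ (-(e : ℤ)))
    (hpE : ‖(p : E)‖ = (p : ℝ) ^ (-((e * f0 : ℕ) : ℤ)))
    {S : Type*} [Fintype S] (emb : S → (F →+* E))
    (hemb : ∀ (σ : S) (z : F), ‖emb σ z‖ = ‖z‖)
    (J : Set S) (d : S → ℕ) (χ1 χ2 : F →* E)
    (hχ1 : IsLocJChar q emb J χ1) (hχ2 : IsLocJChar q emb J χ2)
    (hχ1ne : ∀ z : F, z ≠ 0 → χ1 z ≠ 0) (hχ2ne : ∀ z : F, z ≠ 0 → χ2 z ≠ 0)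
    (r : ℝ) (hrdef : r = -vP p (e * f0) (χ1 (p : F)))
    (hcentral : vP p (e * f0) (χ1 (p : F)) + vP p (e * f0) (χ2 (p : F))
      + (dSum J d : ℝ) = 0)
    (hpos : 0 ≤ vP p (e * f0) (χ2 (p : F)) + (dSum J d : ℝ))
    (hd : ∀ σ, σ ∉ J → (d σ : ℝ) + 1 ≤ r)
    (μ : (F → E) →ₗ[E] E) :
    (∃ C : ℝ, ∀ (a : F) (n : ℤ) (i : S → ℕ), (∀ σ, σ ∉ J → i σ ≤ d σ) →
      ‖μ (test1 q emb a n i)‖ ≤ C * (q : ℝ) ^ ((n : ℝ) * (r - (mSum i : ℝ)))) ↔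
    (∃ C : ℝ,
      (∀ (a : F) (n : ℤ) (i : S → ℕ),
        (∀ z : F, ‖z - a‖ ≤ (q : ℝ) ^ (-n) → (q : ℝ)⁻¹ < ‖z‖) →
        (∀ σ, σ ∉ J → i σ ≤ d σ) →
        ‖μ (test1 q emb a n i)‖ ≤ C * (q : ℝ) ^ ((n : ℝ) * (r - (mSum i : ℝ)))) ∧
      (∀ (a : F) (n : ℤ) (i : S → ℕ), ‖a‖ ≤ (q : ℝ)⁻¹ → 1 ≤ n →
        (∀ σ, σ ∉ J → i σ ≤ d σ) →
        ‖μ (test1 q emb a n i)‖ ≤ C * (q : ℝ) ^ ((n : ℝ) * (r - (mSum i : ℝ)))) ∧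
      (∀ (n : ℤ) (i : S → ℕ), n ≤ 0 → (∀ σ, σ ∉ J → i σ ≤ d σ) → (mSum i : ℝ) < r →
        ‖μ (test1 q emb 0 n i)‖ ≤ C * (q : ℝ) ^ ((n : ℝ) * (r - (mSum i : ℝ))))) := by
  have hq1 : 1 ≤ q := hq ▸ Nat.one_le_pow _ _ (by omega)
  have hq0 : (0 : ℝ) < q := by exact_mod_cast hq1
  have hq1' : (1 : ℝ) ≤ q := by exact_mod_cast hq1
  constructor
  · rintro ⟨C, hC⟩
    exact ⟨C, fun a n i _ hi => hC a n i hi, fun a n i _ _ hi => hC a n i hi,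
      fun n i _ hi _ => hC 0 n i hi⟩
  rintro ⟨C, h1, h2, h3⟩
  have hC0 : 0 ≤ C := by
    have h := (norm_nonneg _).trans (h2 0 1 (fun _ => 0) (by simp) le_rfl (by simp))
    exact nonneg_of_mul_nonneg_left h (by positivity)
  set C' : ℝ := C * (q : ℝ) ^ |r| with hC'
  have hqr : (1 : ℝ) ≤ (q : ℝ) ^ |r| := Real.one_le_rpow hq1' (abs_nonneg r)
  have hCC' : C ≤ C' := le_mul_of_one_le_right hC0 hqr
  have hC'0 : 0 ≤ C' := hC0.trans hCC'
  have hweak : ∀ {x t : ℝ}, x ≤ C * (q : ℝ) ^ t → x ≤ C' * (q : ℝ) ^ t := fun h =>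
    h.trans (by gcongr)
  have hlarge : ∀ i : S → ℕ, (∀ σ, σ ∉ J → i σ ≤ d σ) → r ≤ (mSum i : ℝ) → ∀ n : ℤ, n ≤ 1 →
      ‖μ (test1 q emb 0 n i)‖ ≤ C' * (q : ℝ) ^ ((n : ℝ) * (r - (mSum i : ℝ))) := by
    intro i hi hri n hn
    induction n, hn using Int.leInductionDown with
    | base => exact hweak (h2 0 1 i (by simp) le_rfl hi)
    | pred m hm ih =>
      obtain ⟨n, rfl⟩ : ∃ n, m = n + 1 := ⟨m - 1, by ring⟩
      rw [add_sub_cancel_right]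
      obtain ⟨R, -, hR, hR'⟩ := hres 0 n
      rw [test1_eq_sum_diskMono hq1 emb 0 n i R hR hR', map_sum]
      refine IsUltrametricDist.norm_sum_le_of_forall_le_of_nonneg (by positivity)
        fun x hx => ?_
      by_cases hx0 : ‖x - 0‖ ≤ (q : ℝ) ^ (-(n + 1))
      · rw [diskMono_congr_center q emb 0 i hx0]
        refine le_trans ih (mul_le_mul_of_nonneg_left
          (Real.rpow_le_rpow_of_exponent_le hq1' ?_) hC'0)
        push_cast
        nlinarith
      · refine norm_diskMono_le hq1 hemb μ hC'0 (hR x hx) fun j hj => ?_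
        rw [sub_zero, not_le] at hx0
        have hdisj : ∀ z : F, ‖z - x‖ ≤ (q : ℝ) ^ (-(n + 1)) → (q : ℝ)⁻¹ < ‖z‖ := by
          intro z hz
          have hinv : (q : ℝ)⁻¹ ≤ (q : ℝ) ^ (-(n + 1)) := by
            rw [← zpow_neg_one]
            exact zpow_le_zpow_right₀ hq1' (by omega)
          refine lt_of_le_of_lt hinv (lt_of_not_ge fun hz' => ?_)
          refine absurd hx0 (not_lt.2 ?_)
          rw [← sub_add_cancel x z]
          exact (IsUltrametricDist.norm_add_le_max _ _).trans
            (max_le (norm_sub_rev z x ▸ hz) hz')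
        refine (h1 x (n + 1) j hdisj fun σ hσ => (hj σ).trans (hi σ hσ)).trans ?_
        rw [hC', mul_assoc, ← Real.rpow_add hq0]
        refine mul_le_mul_of_nonneg_left (Real.rpow_le_rpow_of_exponent_le hq1' ?_) hC0
        push_cast
        have := le_abs_self r
        have : (0 : ℝ) ≤ (mSum j : ℝ) := Nat.cast_nonneg _
        nlinarith
  refine ⟨C', fun a n i hi => ?_⟩
  by_cases hdisj : ∀ z : F, ‖z - a‖ ≤ (q : ℝ) ^ (-n) → (q : ℝ)⁻¹ < ‖z‖
  · exact hweak (h1 a n i hdisj hi)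
  push Not at hdisj
  obtain ⟨z, hza, hz⟩ := hdisj
  have ha : ‖a‖ ≤ max (q : ℝ)⁻¹ ((q : ℝ) ^ (-n)) := by
    rw [← add_sub_cancel z a]
    exact (IsUltrametricDist.norm_add_le_max _ _).trans
      (max_le_max hz (norm_sub_rev z a ▸ hza))
  rw [← zpow_neg_one] at ha
  rcases le_or_gt 1 n with hn | hn
  · refine hweak (h2 a n i ?_ hn hi)
    rwa [max_eq_left (zpow_le_zpow_right₀ hq1' (by omega)), zpow_neg_one] at ha
  · rw [max_eq_right (zpow_le_zpow_right₀ hq1' (by omega))] at ha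
    change ‖μ (diskMono q emb a a n i)‖ ≤ _
    rw [diskMono_congr_center q emb (a' := 0) a i (by simpa using ha)]
    refine norm_diskMono_le hq1 hemb μ hC'0 (by simpa using ha) fun j hj => ?_
    have hj' : ∀ σ, σ ∉ J → j σ ≤ d σ := fun σ hσ => (hj σ).trans (hi σ hσ)
    rcases lt_or_ge (mSum j : ℝ) r with hjr | hjr
    · exact hweak (h3 n j (by omega) hj' hjr)
    · exact hlarge j hj' hjr n (by omega)
end Paper
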